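/- Consider the CLTSP with zero-processing times and only deadlines (τ(a) = 0 and r(a) = 0 for all a ∈ A) and slow clients (0 < v < 1). If the instance admits a feasible solution, then there exists an optimal solution (t, x) that is simultaneously order-preserving, has a wait-free server, and has colliding clients. -/

import Mathlib

open scoped BigOperators

/-- An instance of the collaborative line TSP/TRP: a finite set of `n` clients,
a client speed `v > 0`, and for each client a start position `s`, release date
`r ≥ 0`, deadline `d ∈ [0, ∞]` and processing time `tau ≥ 0`. -/
structure CInstance (n : ℕ) where
  v : ℝ
  s : Fin n → ℝ
  r : Fin n → ℝ
  d : Fin n → EReal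
  tau : Fin n → ℝ
  hv : 0 < v
  hr : ∀ a, 0 ≤ r a
  hd : ∀ a, (0 : EReal) ≤ d a
  htau : ∀ a, 0 ≤ tau a

/-- A solution: a serving order `σ` (the `i`-th rendezvous, `i = 0, …, n-1`
in zero-based counting, serves client `σ i`), a rendezvous time `t a` and a
rendezvous position `x a` for every client `a`, and a final time `tEnd` at
which the server is back at the origin. -/
structure CSolution (n : ℕ) where
  σ : Equiv.Perm (Fin n)
  t : Fin n → ℝ
  x : Fin n → ℝ
  tEnd : ℝ

namespace CLTSP

variable {n : ℕ}

/-- Position `x_i` of the `i`-th server stop, `i = 0, …, n+1`; `x_0 = x_{n+1} = 0`. -/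
def pos (sol : CSolution n) (i : ℕ) : ℝ :=
  if h : 1 ≤ i ∧ i ≤ n then sol.x (sol.σ ⟨i - 1, by omega⟩) else 0

/-- Time `t_i` of the `i`-th server stop, `i = 0, …, n+1`; `t_0 = 0`, `t_{n+1} = tEnd`. -/
def time (sol : CSolution n) (i : ℕ) : ℝ :=
  if h : 1 ≤ i ∧ i ≤ n then sol.t (sol.σ ⟨i - 1, by omega⟩)
  else if i = 0 then 0 else sol.tEnd

/-- Completion time `c_i` of the `i`-th rendezvous: `c_0 = 0`,
`c_i = t_i + τ(σ_i)` for `1 ≤ i ≤ n`, and `c_{n+1} = tEnd`. -/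
def comp (I : CInstance n) (sol : CSolution n) (i : ℕ) : ℝ :=
  if h : 1 ≤ i ∧ i ≤ n then
    sol.t (sol.σ ⟨i - 1, by omega⟩) + I.tau (sol.σ ⟨i - 1, by omega⟩)
  else if i = 0 then 0 else sol.tEnd

/-- Feasibility: every rendezvous (including the final return to the origin) is
reachable by the server, every rendezvous is reachable by the corresponding
client, and every client is served within its time window. -/
def Feasible (I : CInstance n) (sol : CSolution n) : Prop :=
  (∀ i : ℕ, 1 ≤ i → i ≤ n + 1 →
      comp I sol (i - 1) + |pos sol i - pos sol (i - 1)| ≤ time sol i) ∧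
  (∀ a, I.r a + |sol.x a - I.s a| / I.v ≤ sol.t a) ∧
  (∀ a, I.r a ≤ sol.t a ∧ (sol.t a : EReal) ≤ I.d a)

/-- The makespan `C_max = c_{n+1}`. -/
def makespan (sol : CSolution n) : ℝ := sol.tEnd

/-- The sum of completion times `C_sum = ∑_{i=1}^n c_i = ∑_a (t a + τ a)`. -/
def csum (I : CInstance n) (sol : CSolution n) : ℝ :=
  ∑ a : Fin n, (sol.t a + I.tau a)

/-- An optimal CLTSP solution: feasible with minimum makespan. -/
def OptimalTSP (I : CInstance n) (sol : CSolution n) : Prop :=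
  Feasible I sol ∧ ∀ sol' : CSolution n, Feasible I sol' → makespan sol ≤ makespan sol'

/-- An optimal CLTRP solution: feasible with minimum sum of completion times. -/
def OptimalTRP (I : CInstance n) (sol : CSolution n) : Prop :=
  Feasible I sol ∧ ∀ sol' : CSolution n, Feasible I sol' → csum I sol ≤ csum I sol'

/-- Order-preserving: for clients `a, a'` both in `L = {a : s a ≤ 0}` or both in
`R = {a : 0 < s a}` with `|s a| < |s a'|` we have `t a < t a'`. -/
def OrderPreserving (I : CInstance n) (sol : CSolution n) : Prop :=
  ∀ a a' : Fin n,
    ((I.s a ≤ 0 ∧ I.s a' ≤ 0) ∨ (0 < I.s a ∧ 0 < I.s a')) →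
    |I.s a| < |I.s a'| → sol.t a < sol.t a'

/-- Wait-free server: `t_i = c_{i-1} + |x_i - x_{i-1}|` for all `1 ≤ i ≤ n+1`. -/
def WaitFree (I : CInstance n) (sol : CSolution n) : Prop :=
  ∀ i : ℕ, 1 ≤ i → i ≤ n + 1 →
    time sol i = comp I sol (i - 1) + |pos sol i - pos sol (i - 1)|

/-- Colliding clients: each client `a = σ_i` satisfies
`t a = max (r a + |s a - x a| / v) (c_{i-1})`. -/
def Colliding (I : CInstance n) (sol : CSolution n) : Prop :=
  ∀ a : Fin n,
    sol.t a = max (I.r a + |I.s a - sol.x a| / I.v)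
      (comp I sol ((sol.σ.symm a : ℕ)))

end CLTSP

namespace CLTSP

variable {n : ℕ}

/-- An order-free description of the feasible solutions of an instance without processing times and
release dates: the rendezvous points, the start `(0, 0)` and the end `(T, 0)` can pairwise be
joined at speed at most one, and every client is served in time. -/
structure Schedule (I : CInstance n) (t x : Fin n → ℝ) (T : ℝ) : Prop where
  nonneg : 0 ≤ T
  start : ∀ a, |x a| ≤ t a
  finish : ∀ a, |x a| ≤ T - t a
  pair : ∀ a b, |x a - x b| ≤ |t a - t b|
  reach : ∀ a, |x a - I.s a| ≤ I.v * t a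
  deadline : ∀ a, (t a : EReal) ≤ I.d a

theorem isCompact_setOf_schedule (I : CInstance n) (T₀ : ℝ) :
    IsCompact {q : (Fin n → ℝ) × (Fin n → ℝ) × ℝ |
      Schedule I q.1 q.2.1 q.2.2 ∧ q.2.2 ≤ T₀} := by
  have hsub : {q : (Fin n → ℝ) × (Fin n → ℝ) × ℝ |
      Schedule I q.1 q.2.1 q.2.2 ∧ q.2.2 ≤ T₀} ⊆
      Set.Icc ((fun _ => 0, fun _ => -T₀, 0) : (Fin n → ℝ) × (Fin n → ℝ) × ℝ)
        (fun _ => T₀, fun _ => T₀, T₀) := by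
    rintro ⟨t, x, T⟩ ⟨h, hT⟩
    have hT' : T ≤ T₀ := hT
    have hx : ∀ a, |x a| ≤ t a ∧ |x a| ≤ T - t a := fun a => ⟨h.start a, h.finish a⟩
    refine ⟨⟨fun a => ?_, fun a => ?_, h.nonneg⟩, fun a => ?_, fun a => ?_, hT⟩ <;>
      · obtain ⟨h1, h2⟩ := hx a
        have h3 := abs_nonneg (x a)
        have h4 := abs_le.1 (le_refl |x a|)
        show _ ≤ _
        dsimp only
        linarith
  refine IsCompact.of_isClosed_subset isCompact_Icc ?_ hsub
  have heq : {q : (Fin n → ℝ) × (Fin n → ℝ) × ℝ |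
      Schedule I q.1 q.2.1 q.2.2 ∧ q.2.2 ≤ T₀} =
      {q | 0 ≤ q.2.2} ∩ (⋂ a, {q | |q.2.1 a| ≤ q.1 a}) ∩ (⋂ a, {q | |q.2.1 a| ≤ q.2.2 - q.1 a}) ∩
      (⋂ a, ⋂ b, {q | |q.2.1 a - q.2.1 b| ≤ |q.1 a - q.1 b|}) ∩
      (⋂ a, {q | |q.2.1 a - I.s a| ≤ I.v * q.1 a}) ∩
      (⋂ a, {q | ((q.1 a : ℝ) : EReal) ≤ I.d a}) ∩ {q | q.2.2 ≤ T₀} := by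
    ext q
    simp only [Set.mem_ofPred_eq, Set.mem_inter_iff, Set.mem_iInter]
    constructor
    · rintro ⟨⟨h1, h2, h3, h4, h5, h6⟩, h7⟩
      exact ⟨⟨⟨⟨⟨⟨h1, h2⟩, h3⟩, h4⟩, h5⟩, h6⟩, h7⟩
    · rintro ⟨⟨⟨⟨⟨⟨h1, h2⟩, h3⟩, h4⟩, h5⟩, h6⟩, h7⟩
      exact ⟨⟨h1, h2, h3, h4, h5, h6⟩, h7⟩
  rw [heq]
  refine (((((IsClosed.inter ?_ ?_).inter ?_).inter ?_).inter ?_).inter ?_).inter ?_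
  · exact isClosed_le (by fun_prop) (by fun_prop)
  · exact isClosed_iInter fun a => isClosed_le (by fun_prop) (by fun_prop)
  · exact isClosed_iInter fun a => isClosed_le (by fun_prop) (by fun_prop)
  · exact isClosed_iInter fun a => isClosed_iInter fun b =>
      isClosed_le (by fun_prop) (by fun_prop)
  · exact isClosed_iInter fun a => isClosed_le (by fun_prop) (by fun_prop)
  · exact isClosed_iInter fun a =>
      isClosed_le (continuous_coe_real_ereal.comp (by fun_prop)) continuous_const
  · exact isClosed_le (by fun_prop) (by fun_prop)

/-- There is a schedule of minimum makespan that, among those, minimizes the sum of the rendezvous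
times. -/
theorem exists_lex_minimal_schedule (I : CInstance n) (h : ∃ t x T, Schedule I t x T) :
    ∃ t x T, Schedule I t x T ∧ (∀ t' x' T', Schedule I t' x' T' → T ≤ T') ∧
      ∀ t' x', Schedule I t' x' T → ∑ a, t a ≤ ∑ a, t' a := by
  obtain ⟨t₀, x₀, T₀, h₀⟩ := h
  obtain ⟨⟨t₁, x₁, T₁⟩, ⟨h₁, hT₁⟩, hmin₁⟩ := (isCompact_setOf_schedule I T₀).exists_isMinOn
    (f := fun q => q.2.2) ⟨(t₀, x₀, T₀), h₀, le_rfl⟩ (by fun_prop)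
  obtain ⟨⟨t₂, x₂, T₂⟩, ⟨h₂, hT₂⟩, hmin₂⟩ := (isCompact_setOf_schedule I T₁).exists_isMinOn
    (f := fun q => ∑ a, q.1 a) ⟨(t₁, x₁, T₁), h₁, le_rfl⟩ (by fun_prop)
  dsimp only at h₁ hT₁ h₂ hT₂
  have hopt : ∀ t' x' T', Schedule I t' x' T' → T₁ ≤ T' := by
    intro t' x' T' h'
    rcases le_total T' T₀ with hle | hle
    · exact isMinOn_iff.1 hmin₁ (t', x', T') ⟨h', hle⟩
    · exact hT₁.trans hle
  refine ⟨t₂, x₂, T₂, h₂, fun t' x' T' h' => hT₂.trans (hopt _ _ _ h'), fun t' x' h' => ?_⟩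
  exact isMinOn_iff.1 hmin₂ (t', x', T₂) ⟨h', hT₂⟩

/-- Replacing the rendezvous point of one client by an earlier admissible one. -/
theorem Schedule.update {I : CInstance n} {t x : Fin n → ℝ} {T : ℝ} (h : Schedule I t x T)
    {a : Fin n} {t' x' : ℝ} (hlt : t' < t a) (hstart : |x'| ≤ t')
    (hreach : |x' - I.s a| ≤ I.v * t') (hmove : |x' - x a| ≤ t a - t')
    (hpair : ∀ b, b ≠ a → |x' - x b| ≤ |t' - t b|) :
    Schedule I (Function.update t a t') (Function.update x a x') T := by
  refine ⟨h.nonneg, fun b => ?_, fun b => ?_, fun b c => ?_, fun b => ?_, fun b => ?_⟩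
  · rcases eq_or_ne b a with rfl | hb
    · simpa using hstart
    · simpa [hb] using h.start b
  · rcases eq_or_ne b a with rfl | hb
    · have h1 := h.finish b
      have h2 := abs_sub_abs_le_abs_sub x' (x b)
      simp only [Function.update_self]
      linarith
    · simpa [hb] using h.finish b
  · rcases eq_or_ne b a with rfl | hb
    · rcases eq_or_ne c b with rfl | hc
      · simp
      · simpa [hc] using hpair c hc
    · rcases eq_or_ne c a with rfl | hc
      · simpa [hb, abs_sub_comm] using hpair b hb
      · simpa [hb, hc] using h.pair b c
  · rcases eq_or_ne b a with rfl | hb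
    · simpa using hreach
    · simpa [hb] using h.reach b
  · rcases eq_or_ne b a with rfl | hb
    · simpa using (EReal.coe_le_coe_iff.2 hlt.le).trans (h.deadline b)
    · simpa [hb] using h.deadline b

theorem Schedule.not_improvable {I : CInstance n} {t x : Fin n → ℝ} {T : ℝ}
    (h : Schedule I t x T) (hmin : ∀ t' x', Schedule I t' x' T → ∑ a, t a ≤ ∑ a, t' a)
    {a : Fin n} {t' x' : ℝ} (hlt : t' < t a) (hstart : |x'| ≤ t')
    (hreach : |x' - I.s a| ≤ I.v * t') (hmove : |x' - x a| ≤ t a - t')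
    (hpair : ∀ b, b ≠ a → |x' - x b| ≤ |t' - t b|) : False := by
  refine absurd (hmin _ _ (h.update hlt hstart hreach hmove hpair)) (not_le.2 ?_)
  refine Finset.sum_lt_sum (fun b _ => ?_) ⟨a, Finset.mem_univ a, by simpa using hlt⟩
  rcases eq_or_ne b a with rfl | hb
  · simpa using hlt.le
  · simp [hb]

/-- `(t₀, x₀)` is the stop of the server immediately preceding the rendezvous with client `a`. -/
structure IsPrevStop (t x : Fin n → ℝ) (a : Fin n) (t₀ x₀ : ℝ) : Prop where
  start : |x₀| ≤ t₀
  step : |x a - x₀| ≤ t a - t₀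
  before_or_after : ∀ b, b ≠ a → t a ≤ t b ∨ |x b - x₀| ≤ t₀ - t b

/-- Moving the rendezvous with `a` to an earlier point is compatible with all other rendezvous as
soon as it is compatible with the preceding stop. -/
theorem Schedule.not_improvable_of_prevStop {I : CInstance n} {t x : Fin n → ℝ} {T : ℝ}
    (h : Schedule I t x T) (hmin : ∀ t' x', Schedule I t' x' T → ∑ a, t a ≤ ∑ a, t' a)
    {a : Fin n} {t₀ x₀ : ℝ} (hp : IsPrevStop t x a t₀ x₀)
    {t' x' : ℝ} (hlt : t' < t a) (hstep : |x' - x₀| ≤ t' - t₀)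
    (hreach : |x' - I.s a| ≤ I.v * t') (hmove : |x' - x a| ≤ t a - t') : False := by
  refine h.not_improvable hmin hlt ?_ hreach hmove fun b hb => ?_
  · have h1 := abs_sub_abs_le_abs_sub x' x₀
    have h2 := hp.start
    linarith
  · rcases hp.before_or_after b hb with hab | hba
    · have h1 := abs_sub_le x' (x a) (x b)
      have h2 := h.pair a b
      rw [abs_sub_comm (t a), abs_of_nonneg (sub_nonneg.2 hab)] at h2
      have h3 := neg_le_abs (t' - t b)
      linarith
    · have h1 := abs_sub_le x' x₀ (x b)
      rw [abs_sub_comm x₀] at h1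
      have h3 := le_abs_self (t' - t b)
      linarith

theorem Schedule.waitFree_of_minimal {I : CInstance n} {t x : Fin n → ℝ} {T : ℝ}
    (hslow : I.v < 1) (h : Schedule I t x T)
    (hmin : ∀ t' x', Schedule I t' x' T → ∑ a, t a ≤ ∑ a, t' a)
    {a : Fin n} {t₀ x₀ : ℝ} (hp : IsPrevStop t x a t₀ x₀) :
    t a = t₀ + |x a - x₀| := by
  by_contra hne
  have hstep := hp.step
  have hδ : 0 < t a - t₀ - |x a - x₀| :=
    lt_of_le_of_ne (by linarith) fun h0 => hne (by linarith)
  set ε := (t a - t₀ - |x a - x₀|) / 2 with hε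
  have hε0 : 0 < ε := by positivity
  have ht₀ : 0 ≤ t₀ := (abs_nonneg _).trans hp.start
  have hεt : ε ≤ t a := by linarith [abs_nonneg (x a - x₀)]
  have hta : 0 < t a := hε0.trans_le hεt
  have hr := h.reach a
  have hratio : ε / t a ≤ 1 := (div_le_one hta).2 hεt
  have hratio0 : 0 ≤ ε / t a := by positivity
  have hcancel : ε / t a * (I.v * t a) = I.v * ε := by field_simp
  have hvε : I.v * ε ≤ ε := by nlinarith
  have hshift : |x a + ε / t a * (I.s a - x a) - x a| ≤ I.v * ε := by
    rw [add_sub_cancel_left, abs_mul, abs_of_nonneg hratio0, abs_sub_comm, ← hcancel]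
    exact mul_le_mul_of_nonneg_left hr hratio0
  refine h.not_improvable_of_prevStop hmin hp (t' := t a - ε)
    (x' := x a + ε / t a * (I.s a - x a)) (by linarith) ?_ ?_ ?_
  · have h1 := abs_sub_le (x a + ε / t a * (I.s a - x a)) (x a) x₀
    linarith
  · have h1 : x a + ε / t a * (I.s a - x a) - I.s a = (1 - ε / t a) * (x a - I.s a) := by ring
    rw [h1, abs_mul, abs_of_nonneg (sub_nonneg.2 hratio)]
    have h2 := mul_le_mul_of_nonneg_left hr (sub_nonneg.2 hratio)
    linarith
  · linarith

theorem Schedule.colliding_of_minimal {I : CInstance n} {t x : Fin n → ℝ} {T : ℝ}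
    (hslow : I.v < 1) (h : Schedule I t x T)
    (hmin : ∀ t' x', Schedule I t' x' T → ∑ a, t a ≤ ∑ a, t' a)
    {a : Fin n} {t₀ x₀ : ℝ} (hp : IsPrevStop t x a t₀ x₀) :
    t a = max (|I.s a - x a| / I.v) t₀ := by
  have hv := I.hv
  have hwait := h.waitFree_of_minimal hslow hmin hp
  have hr : |I.s a - x a| ≤ I.v * t a := by
    rw [abs_sub_comm]; exact h.reach a
  refine le_antisymm ?_ (max_le ((div_le_iff₀' hv).2 hr) (by linarith [abs_nonneg (x a - x₀)]))
  by_contra! hlt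
  obtain ⟨hlt1, hlt2⟩ := max_lt_iff.1 hlt
  rw [div_lt_iff₀' hv] at hlt1
  set D := |x a - x₀| with hD
  have hD0 : 0 < D := by linarith
  set ε := min D ((I.v * t a - |I.s a - x a|) / 2) with hε
  have hε0 : 0 < ε := lt_min hD0 (by linarith)
  have hεD : ε ≤ D := min_le_left _ _
  have hεr : ε ≤ (I.v * t a - |I.s a - x a|) / 2 := min_le_right _ _
  have hratio : ε / D ≤ 1 := (div_le_one hD0).2 hεD
  have hratio0 : 0 ≤ ε / D := by positivity
  have hcancel : ε / D * D = ε := by field_simp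
  have hvε : I.v * ε ≤ ε := by nlinarith
  have hshift : |x a + ε / D * (x₀ - x a) - x a| = ε := by
    rw [add_sub_cancel_left, abs_mul, abs_of_nonneg hratio0, abs_sub_comm, ← hD, hcancel]
  refine h.not_improvable_of_prevStop hmin hp (t' := t a - ε)
    (x' := x a + ε / D * (x₀ - x a)) (by linarith) ?_ ?_ ?_
  · have h1 : x a + ε / D * (x₀ - x a) - x₀ = (1 - ε / D) * (x a - x₀) := by ring
    rw [h1, abs_mul, abs_of_nonneg (sub_nonneg.2 hratio), ← hD]
    linarith
  · have h1 := abs_sub_le (x a + ε / D * (x₀ - x a)) (x a) (I.s a)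
    rw [abs_sub_comm (x a) (I.s a)] at h1
    linarith
  · linarith

/-- Points that can pairwise be joined at speed at most one lie on the graph of a
one-Lipschitz function. -/
theorem exists_lipschitz_interpolation {ι : Type*} {t x : ι → ℝ}
    (h : ∀ i j, |x i - x j| ≤ |t i - t j|) :
    ∃ p : ℝ → ℝ, LipschitzWith 1 p ∧ ∀ i, p (t i) = x i := by
  classical
  set f : ℝ → ℝ := fun τ => if hτ : ∃ i, t i = τ then x hτ.choose else 0 with hf
  have hft : ∀ i, f (t i) = x i := by
    intro i
    have hi : ∃ j, t j = t i := ⟨i, rfl⟩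
    have h1 := h hi.choose i
    rw [hi.choose_spec, sub_self, abs_zero] at h1
    simp only [hf, dif_pos hi]
    exact sub_eq_zero.1 (abs_nonpos_iff.1 h1)
  have hlip : LipschitzOnWith 1 f (Set.range t) := by
    refine LipschitzOnWith.of_dist_le_mul ?_
    rintro _ ⟨i, rfl⟩ _ ⟨j, rfl⟩
    simpa [hft, Real.dist_eq] using h i j
  obtain ⟨p, hp, hpf⟩ := hlip.extend_real
  exact ⟨p, hp, fun i => (hpf ⟨i, rfl⟩).symm.trans (hft i)⟩

theorem Schedule.exists_server_path {I : CInstance n} {t x : Fin n → ℝ} {T : ℝ}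
    (h : Schedule I t x T) :
    ∃ p : ℝ → ℝ, LipschitzWith 1 p ∧ p 0 = 0 ∧ ∀ a, p (t a) = x a := by
  have ht : ∀ a, 0 ≤ t a := fun a => (abs_nonneg _).trans (h.start a)
  obtain ⟨p, hp, hpt⟩ := exists_lipschitz_interpolation
    (t := fun o : Option (Fin n) => o.elim 0 t) (x := fun o => o.elim 0 x) (by
      rintro (_ | a) (_ | b)
      · simp
      · simpa [abs_of_nonneg (ht b)] using h.start b
      · simpa [abs_of_nonneg (ht a)] using h.start a
      · exact h.pair a b)
  exact ⟨p, hp, hpt none, fun a => hpt (some a)⟩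

/-- The server meets the clients on one side of the origin in the order of their distances: it
crosses the front line of the closer client before that of the farther one. -/
theorem Schedule.lt_of_minimal {I : CInstance n} {t x : Fin n → ℝ} {T : ℝ}
    (h : Schedule I t x T) (hmin : ∀ t' x', Schedule I t' x' T → ∑ a, t a ≤ ∑ a, t' a)
    {a a' : Fin n} {e : ℝ} (he : |e| = 1) (hs0 : 0 ≤ e * I.s a)
    (hs : e * I.s a < e * I.s a') : t a < t a' := by
  obtain ⟨p, hp, hp0, hpt⟩ := h.exists_server_path
  by_contra! hle
  have ht' : 0 ≤ t a' := (abs_nonneg _).trans (h.start a')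
  have hdist : ∀ u w, |p u - p w| ≤ |u - w| := by
    intro u w
    simpa [Real.dist_eq] using hp.dist_le_mul u w
  have hcont : ContinuousOn (fun τ => e * p τ + I.v * τ) (Set.Icc 0 (t a')) := by
    have := hp.continuous
    fun_prop
  have hfar : e * I.s a' ≤ e * p (t a') + I.v * t a' := by
    have h1 := h.reach a'
    have h2 := neg_le_abs (e * (x a' - I.s a'))
    rw [abs_mul, he, one_mul] at h2
    rw [hpt]
    linarith
  obtain ⟨τ, ⟨hτ0, hτ1⟩, hτ⟩ := intermediate_value_Icc ht' hcont
    (show e * I.s a ∈ Set.Icc _ _ from ⟨by simpa [hp0] using hs0, by linarith⟩)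
  dsimp only at hτ
  have hτlt : τ < t a' := lt_of_le_of_ne hτ1 (by rintro rfl; linarith)
  refine h.not_improvable hmin (a := a) (t' := τ) (x' := p τ) (by linarith) ?_ ?_ ?_ ?_
  · simpa [hp0, abs_of_nonneg hτ0] using hdist τ 0
  · rw [← one_mul |p τ - I.s a|, ← he, ← abs_mul, mul_sub]
    rw [← hτ, sub_add_cancel_left, abs_neg, abs_of_nonneg (mul_nonneg I.hv.le hτ0)]
  · have h1 := hdist τ (t a)
    rwa [hpt, abs_sub_comm τ, abs_of_nonneg (by linarith : 0 ≤ t a - τ)] at h1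
  · intro b _
    simpa [hpt] using hdist τ (t b)

theorem time_zero (sol : CSolution n) : time sol 0 = 0 := by simp [time]

theorem pos_zero (sol : CSolution n) : pos sol 0 = 0 := by simp [pos]

theorem time_last (sol : CSolution n) : time sol (n + 1) = sol.tEnd := by simp [time]

theorem pos_last (sol : CSolution n) : pos sol (n + 1) = 0 := by simp [pos]

theorem time_succ (sol : CSolution n) (k : Fin n) : time sol (k + 1) = sol.t (sol.σ k) := by
  simp [time]

theorem pos_succ (sol : CSolution n) (k : Fin n) : pos sol (k + 1) = sol.x (sol.σ k) := by
  simp [pos]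

theorem comp_eq_time {I : CInstance n} (htau : ∀ a, I.tau a = 0) (sol : CSolution n) (i : ℕ) :
    comp I sol i = time sol i := by
  simp [comp, time, htau]

theorem Feasible.schedule {I : CInstance n} (htau : ∀ a, I.tau a = 0) (hrel : ∀ a, I.r a = 0)
    {sol : CSolution n} (h : Feasible I sol) : Schedule I sol.t sol.x sol.tEnd := by
  obtain ⟨hserver, hclient, hwindow⟩ := h
  simp only [comp_eq_time htau, hrel] at hserver hclient hwindow
  have hchain : ∀ i j, i ≤ j → j ≤ n + 1 →
      |pos sol j - pos sol i| ≤ time sol j - time sol i := by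
    intro i j hij
    induction j, hij using Nat.le_induction with
    | base => simp
    | succ j _ ih =>
      intro hj
      have h1 := ih (by omega)
      have h2 := hserver (j + 1) (by omega) hj
      have h3 := abs_sub_le (pos sol (j + 1)) (pos sol j) (pos sol i)
      rw [Nat.add_sub_cancel] at h2
      linarith
  have ht : ∀ a, time sol (sol.σ.symm a + 1) = sol.t a := fun a => by
    rw [time_succ, Equiv.apply_symm_apply]
  have hx : ∀ a, pos sol (sol.σ.symm a + 1) = sol.x a := fun a => by
    rw [pos_succ, Equiv.apply_symm_apply]
  have hpair : ∀ a b, sol.σ.symm a ≤ sol.σ.symm b →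
      |sol.x a - sol.x b| ≤ |sol.t a - sol.t b| := by
    intro a b hab
    have h1 := hchain (sol.σ.symm a + 1) (sol.σ.symm b + 1)
      (Nat.succ_le_succ hab) (by omega)
    rw [ht, ht, hx, hx] at h1
    rw [abs_sub_comm, abs_sub_comm (sol.t a)]
    exact h1.trans (le_abs_self _)
  refine ⟨?_, fun a => ?_, fun a => ?_, fun a b => ?_, fun a => ?_, fun a => (hwindow a).2⟩
  · simpa [time_zero, pos_zero, time_last, pos_last] using hchain 0 (n + 1) (by omega) le_rfl
  · simpa [time_zero, pos_zero, ht, hx] using hchain 0 (sol.σ.symm a + 1) (by omega) (by omega)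
  · simpa [time_last, pos_last, ht, hx] using
      hchain (sol.σ.symm a + 1) (n + 1) (by omega) le_rfl
  · rcases le_total (sol.σ.symm a) (sol.σ.symm b) with hab | hba
    · exact hpair a b hab
    · rw [abs_sub_comm, abs_sub_comm (sol.t a)]
      exact hpair b a hba
  · have h1 := hclient a
    rw [zero_add, div_le_iff₀' I.hv] at h1
    exact h1

/-- The solution that serves the clients of a schedule in the order of their rendezvous times. -/
noncomputable def sortedSolution (t x : Fin n → ℝ) (T : ℝ) : CSolution n :=
  ⟨Tuple.sort t, t, x, T⟩

theorem Schedule.isPrevStop_sortedSolution {I : CInstance n} {t x : Fin n → ℝ} {T : ℝ}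
    (h : Schedule I t x T) (k : Fin n) :
    IsPrevStop t x (Tuple.sort t k) (time (sortedSolution t x T) k)
      (pos (sortedSolution t x T) k) := by
  have hmono : Monotone (t ∘ Tuple.sort t) := Tuple.monotone_sort t
  have hpair : ∀ i j, i ≤ j → |x (Tuple.sort t j) - x (Tuple.sort t i)| ≤
      t (Tuple.sort t j) - t (Tuple.sort t i) := fun i j hij =>
    (h.pair _ _).trans_eq (abs_of_nonneg (sub_nonneg.2 (hmono hij)))
  obtain ⟨k, hk⟩ := k
  rcases k with _ | m
  · simp only [time_zero, pos_zero]
    refine ⟨by simp, by simpa using h.start _, fun b _ => Or.inl ?_⟩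
    obtain ⟨j, rfl⟩ := (Tuple.sort t).surjective b
    exact hmono (Fin.mk_le_of_le_val (Nat.zero_le _))
  · have ht : time (sortedSolution t x T) (m + 1) = t (Tuple.sort t ⟨m, by omega⟩) :=
      time_succ (sortedSolution t x T) ⟨m, by omega⟩
    have hx : pos (sortedSolution t x T) (m + 1) = x (Tuple.sort t ⟨m, by omega⟩) :=
      pos_succ (sortedSolution t x T) ⟨m, by omega⟩
    simp only [ht, hx]
    refine ⟨h.start _, hpair _ _ (Fin.mk_le_mk.2 (by omega)), fun b _ => ?_⟩
    obtain ⟨j, rfl⟩ := (Tuple.sort t).surjective b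
    rcases le_or_gt (⟨m + 1, hk⟩ : Fin n) j with hj | hj
    · exact Or.inl (hmono hj)
    · right
      rw [abs_sub_comm]
      exact hpair _ _ (Nat.le_of_lt_succ hj)

theorem Schedule.last_step_sortedSolution {I : CInstance n} {t x : Fin n → ℝ} {T : ℝ}
    (h : Schedule I t x T) :
    time (sortedSolution t x T) n + |pos (sortedSolution t x T) n| ≤ T := by
  rcases n with _ | m
  · simpa [time_zero, pos_zero] using h.nonneg
  · have ht := time_succ (sortedSolution t x T) (Fin.last m)
    have hx := pos_succ (sortedSolution t x T) (Fin.last m)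
    rw [Fin.val_last] at ht hx
    rw [ht, hx]
    have := h.finish (Tuple.sort t (Fin.last m))
    simp only [sortedSolution]
    linarith

/-- The server can return to the origin immediately after its last rendezvous. -/
theorem Schedule.shorten {I : CInstance n} {t x : Fin n → ℝ} {T : ℝ} (h : Schedule I t x T) :
    Schedule I t x (time (sortedSolution t x T) n + |pos (sortedSolution t x T) n|) := by
  refine ⟨?_, h.start, fun a => ?_, h.pair, h.reach, h.deadline⟩
  · rcases n with _ | m
    · simp [time_zero, pos_zero]
    · have ht := time_succ (sortedSolution t x T) (Fin.last m)
      rw [Fin.val_last] at ht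
      rw [ht]
      exact add_nonneg ((abs_nonneg _).trans (h.start _)) (abs_nonneg _)
  · rcases n with _ | m
    · exact a.elim0
    · have ht := time_succ (sortedSolution t x T) (Fin.last m)
      have hx := pos_succ (sortedSolution t x T) (Fin.last m)
      rw [Fin.val_last] at ht hx
      rw [ht, hx]
      obtain ⟨j, rfl⟩ := (Tuple.sort t).surjective a
      have h1 : t (Tuple.sort t j) ≤ t (Tuple.sort t (Fin.last m)) :=
        Tuple.monotone_sort t (Fin.le_last j)
      have h2 := h.pair (Tuple.sort t j) (Tuple.sort t (Fin.last m))
      rw [abs_sub_comm (t _), abs_of_nonneg (sub_nonneg.2 h1)] at h2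
      have h3 := abs_sub_abs_le_abs_sub (x (Tuple.sort t j)) (x (Tuple.sort t (Fin.last m)))
      simp only [sortedSolution]
      linarith

theorem Schedule.feasible_sortedSolution {I : CInstance n} (htau : ∀ a, I.tau a = 0)
    (hrel : ∀ a, I.r a = 0) {t x : Fin n → ℝ} {T : ℝ} (h : Schedule I t x T) :
    Feasible I (sortedSolution t x T) := by
  refine ⟨fun i hi1 hi2 => ?_, fun a => ?_, fun a => ⟨?_, h.deadline a⟩⟩
  · obtain ⟨k, rfl⟩ := Nat.exists_eq_add_of_le' hi1
    rw [comp_eq_time htau, Nat.add_sub_cancel]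
    rcases Nat.lt_or_ge k n with hk | hk
    · have h1 := (h.isPrevStop_sortedSolution ⟨k, hk⟩).step
      have ht := time_succ (sortedSolution t x T) ⟨k, hk⟩
      have hx := pos_succ (sortedSolution t x T) ⟨k, hk⟩
      dsimp only at ht hx
      rw [ht, hx]
      simp only [sortedSolution] at h1 ⊢
      linarith
    · obtain rfl : k = n := by omega
      rw [time_last, pos_last, zero_sub, abs_neg]
      exact h.last_step_sortedSolution
  · rw [hrel, zero_add, div_le_iff₀' I.hv]
    exact h.reach a
  · rw [hrel]
    exact (abs_nonneg _).trans (h.start a)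

end CLTSP

open CLTSP in
/-- CLTSP with zero processing times, only deadlines and slow
clients: if a feasible solution exists, there exists an optimal solution that
is simultaneously order-preserving, has a wait-free server and has colliding
clients. -/
theorem cltsp_zeroProc_deadlines_slow_exists_structured_optimal
    {n : ℕ} (I : CInstance n)
    (htau : ∀ a, I.tau a = 0) (hrel : ∀ a, I.r a = 0) (hslow : I.v < 1)
    (hfeas : ∃ sol : CSolution n, Feasible I sol) :
    ∃ sol : CSolution n, OptimalTSP I sol ∧
      OrderPreserving I sol ∧ WaitFree I sol ∧ Colliding I sol := by
  obtain ⟨sol₀, hsol₀⟩ := hfeas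
  obtain ⟨t, x, T, h, hT, hmin⟩ :=
    exists_lex_minimal_schedule I ⟨_, _, _, hsol₀.schedule htau hrel⟩
  refine ⟨sortedSolution t x T, ⟨h.feasible_sortedSolution htau hrel, fun sol' h' =>
    hT _ _ _ (h'.schedule htau hrel)⟩, ?_, ?_, ?_⟩
  · rintro a a' (⟨ha, ha'⟩ | ⟨ha, ha'⟩) hlt
    · rw [abs_of_nonpos ha, abs_of_nonpos ha'] at hlt
      exact h.lt_of_minimal hmin (e := -1) (by simp) (by linarith) (by linarith)
    · rw [abs_of_pos ha, abs_of_pos ha'] at hlt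
      exact h.lt_of_minimal hmin (e := 1) (by simp) (by linarith) (by linarith)
  · intro i hi1 hi2
    obtain ⟨k, rfl⟩ := Nat.exists_eq_add_of_le' hi1
    rw [comp_eq_time htau, Nat.add_sub_cancel]
    rcases Nat.lt_or_ge k n with hk | hk
    · have ht := time_succ (sortedSolution t x T) ⟨k, hk⟩
      have hx := pos_succ (sortedSolution t x T) ⟨k, hk⟩
      dsimp only at ht hx
      rw [ht, hx]
      exact h.waitFree_of_minimal hslow hmin (h.isPrevStop_sortedSolution ⟨k, hk⟩)
    · obtain rfl : k = n := by omega
      rw [time_last, pos_last, zero_sub, abs_neg]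
      exact le_antisymm (hT _ _ _ h.shorten) h.last_step_sortedSolution
  · intro a
    obtain ⟨k, rfl⟩ := (Tuple.sort t).surjective a
    have hk : (sortedSolution t x T).σ.symm (Tuple.sort t k) = k :=
      (Tuple.sort t).symm_apply_apply k
    rw [comp_eq_time htau, hrel, zero_add, hk]
    exact h.colliding_of_minimal hslow hmin (h.isPrevStop_sortedSolution k)
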